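/- There is an absolute constant C > 0 such that for all real x ≥ 3 and all integers b ≥ 1, J ≥ 1 and 1 ≤ j ≤ J: |Σ_{k ∈ M_j \ M_{j−1}} (1/k) · #{m ∈ M : k | m} − (|M|/J) · e^γ · log x| ≤ C · (|M|/J) · e^γ · log x · (J·(log log x)/b + J²/(log x)). -/

import Mathlib

open Finset Real

/-- `P x b = ∏_{p ≤ x} p^(b-1)`, product over primes `p ≤ x`. -/
noncomputable def resonatorProd (x : ℝ) (b : ℕ) : ℕ :=
  ∏ p ∈ (Finset.range (⌊x⌋₊ + 1)).filter Nat.Prime, p ^ (b - 1)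

theorem log_factorial_eq_sum_primesLE (N : ℕ) :
    log (N.factorial : ℝ) = ∑ p ∈ N.primesLE, (N.factorial.factorization p : ℝ) * log p := by
  rw [Real.log_nat_eq_sum_factorization]
  refine Finsupp.sum_of_support_subset _ (fun p hp => ?_) _ (by simp)
  rw [Nat.support_factorization] at hp
  have h := Nat.prime_of_mem_primeFactors hp
  exact Nat.mem_primesLE.2 ⟨(h.dvd_factorial).1 (Nat.dvd_of_mem_primeFactors hp), h⟩

theorem mul_log_sub_le_log_factorial {N : ℕ} (hN : 1 ≤ N) :
    N * log N - N ≤ log (N.factorial : ℝ) := by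
  have hN' : (0 : ℝ) < N := by exact_mod_cast hN
  have h := Real.pow_div_factorial_le_exp (N : ℝ) hN'.le N
  have h2 := Real.log_le_log (by positivity) h
  rw [Real.log_exp, Real.log_div (by positivity) (by positivity), Real.log_pow] at h2
  linarith

theorem log_factorial_le_mul_log (N : ℕ) : log (N.factorial : ℝ) ≤ N * log N := by
  rw [← Real.log_pow]
  exact Real.log_le_log (by positivity) (by exact_mod_cast Nat.factorial_le_pow N)

theorem sum_log_div_primesLE_le {N : ℕ} (hN : 1 ≤ N) :
    ∑ p ∈ N.primesLE, log p / p ≤ log N + log 4 := by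
  have hN' : (0 : ℝ) < N := by exact_mod_cast hN
  have h1 : ∑ p ∈ N.primesLE, ((N : ℝ) / p - 1) * log p ≤ log (N.factorial : ℝ) := by
    rw [log_factorial_eq_sum_primesLE]
    refine Finset.sum_le_sum fun p hp => ?_
    obtain ⟨hpN, hp⟩ := Nat.mem_primesLE.1 hp
    refine mul_le_mul_of_nonneg_right ?_ (Real.log_natCast_nonneg p)
    have h2 : N / p ≤ N.factorial.factorization p := by
      rw [Nat.factorization_factorial hp (Nat.lt_succ_self _)]
      have hmem : 1 ∈ Finset.Ico 1 (Nat.log p N).succ := by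
        exact Finset.mem_Ico.2 ⟨le_rfl, Nat.succ_lt_succ (Nat.log_pos hp.one_lt hpN)⟩
      simpa using Finset.single_le_sum (f := fun i => N / p ^ i) (fun i _ => Nat.zero_le _) hmem
    have h3 : (N : ℝ) / p ≤ (N / p : ℕ) + 1 := by
      have := (Nat.lt_floor_add_one ((N : ℝ) / p)).le
      rwa [Nat.floor_div_natCast, Nat.floor_natCast] at this
    have h4 : ((N / p : ℕ) : ℝ) ≤ N.factorial.factorization p := by exact_mod_cast h2
    linarith
  have h2 := Chebyshev.theta_le_log4_mul_x hN'.le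
  rw [Chebyshev.theta_eq_sum_primesLE_log] at h2
  have h3 := log_factorial_le_mul_log N
  have h4 : ∑ p ∈ N.primesLE, ((N : ℝ) / p - 1) * log p =
      N * (∑ p ∈ N.primesLE, log p / p) - ∑ p ∈ N.primesLE, log p := by
    rw [Finset.mul_sum, ← Finset.sum_sub_distrib]
    refine Finset.sum_congr rfl fun p _ => by ring
  refine le_of_mul_le_mul_left ?_ hN'
  linarith

theorem summable_log_div_mul_sub_one :
    Summable fun n : ℕ => log n / (n * (n - 1)) := by
  have h : Summable fun n : ℕ => 4 * (1 / (n : ℝ) ^ (3 / 2 : ℝ)) :=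
    (Real.summable_one_div_nat_rpow.2 (by norm_num)).mul_left 4
  refine Summable.of_norm_bounded h fun n => ?_
  rcases Nat.lt_or_ge n 2 with hn | hn
  · interval_cases n <;> simp
  · have hn' : (2 : ℝ) ≤ n := by exact_mod_cast hn
    have h0 : (0 : ℝ) < n := by linarith
    have hl : log n ≤ (n : ℝ) ^ (1 / 2 : ℝ) / (1 / 2) :=
      Real.log_le_rpow_div h0.le (by norm_num)
    rw [Real.norm_of_nonneg (div_nonneg (Real.log_natCast_nonneg n) (by nlinarith))]
    rw [mul_one_div, div_le_div_iff₀ (by nlinarith) (by positivity)]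
    have e : (n : ℝ) ^ (1 / 2 : ℝ) * (n : ℝ) ^ (3 / 2 : ℝ) = n ^ 2 := by
      rw [← Real.rpow_add h0]; norm_num
    calc log n * (n : ℝ) ^ (3 / 2 : ℝ) ≤ (n : ℝ) ^ (1 / 2 : ℝ) / (1 / 2) * (n : ℝ) ^ (3 / 2 : ℝ) := by
          gcongr
      _ = 2 * n ^ 2 := by rw [← e]; ring
      _ ≤ 4 * (n * (n - 1)) := by nlinarith

/-- The first theorem of Mertens. -/
theorem exists_abs_sum_log_div_primesLE_sub_log_le :
    ∃ K : ℝ, 0 < K ∧ ∀ N : ℕ, 1 ≤ N → |∑ p ∈ N.primesLE, log p / p - log N| ≤ K := by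
  set T := ∑' n : ℕ, log n / ((n : ℝ) * (n - 1)) with hT
  have hnn : ∀ n : ℕ, 0 ≤ log n / ((n : ℝ) * (n - 1)) := fun n => by
    rcases Nat.eq_zero_or_pos n with rfl | hn
    · simp
    · have : (1 : ℝ) ≤ n := by exact_mod_cast hn
      exact div_nonneg (Real.log_natCast_nonneg n) (by nlinarith)
  have hT0 : 0 ≤ T := tsum_nonneg hnn
  have h4 : 0 < log 4 := Real.log_pos (by norm_num)
  refine ⟨T + 1 + log 4, by positivity, fun N hN => abs_le.2 ⟨?_, ?_⟩⟩
  · have hN' : (0 : ℝ) < N := by exact_mod_cast hN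
    have h1 : log (N.factorial : ℝ) ≤ ∑ p ∈ N.primesLE, (N : ℝ) / (p - 1) * log p := by
      rw [log_factorial_eq_sum_primesLE]
      refine Finset.sum_le_sum fun p hp => ?_
      obtain ⟨hpN, hp⟩ := Nat.mem_primesLE.1 hp
      refine mul_le_mul_of_nonneg_right ?_ (Real.log_natCast_nonneg p)
      have h2 := Nat.factorization_factorial_le_div_pred hp N
      have h3 : ((N / (p - 1) : ℕ) : ℝ) ≤ (N : ℝ) / ((p - 1 : ℕ) : ℝ) := Nat.cast_div_le
      rw [Nat.cast_sub hp.one_le, Nat.cast_one] at h3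
      exact le_trans (by exact_mod_cast h2) h3
    have h2 : ∑ p ∈ N.primesLE, (N : ℝ) / (p - 1) * log p =
        N * (∑ p ∈ N.primesLE, log p / p + ∑ p ∈ N.primesLE, log p / ((p : ℝ) * (p - 1))) := by
      rw [← Finset.sum_add_distrib, Finset.mul_sum]
      refine Finset.sum_congr rfl fun p hp => ?_
      have : (1 : ℝ) < p := by exact_mod_cast (Nat.mem_primesLE.1 hp).2.one_lt
      have : (p : ℝ) - 1 ≠ 0 := by linarith
      field_simp
      ring
    have h3 : ∑ p ∈ N.primesLE, log p / ((p : ℝ) * (p - 1)) ≤ T :=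
      summable_log_div_mul_sub_one.sum_le_tsum _ fun n _ => hnn n
    have h5 := mul_log_sub_le_log_factorial hN
    have h6 : log N - 1 ≤
        ∑ p ∈ N.primesLE, log p / p + ∑ p ∈ N.primesLE, log p / ((p : ℝ) * (p - 1)) := by
      refine le_of_mul_le_mul_left ?_ hN'
      linarith
    linarith
  · linarith [sum_log_div_primesLE_le hN]

theorem abs_one_sub_div_sub_log_div_le {a b : ℝ} (ha : 0 < a) (hab : a ≤ b) (hb : b ≤ a + 1) :
    |1 - a / b - (log b - log a)| ≤ 1 / a - 1 / b := by
  have hb0 : 0 < b := by linarith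
  have h1 : log (b / a) ≤ b / a - 1 := Real.log_le_sub_one_of_pos (by positivity)
  have h2 : 1 - (b / a)⁻¹ ≤ log (b / a) := Real.one_sub_inv_le_log_of_pos (by positivity)
  rw [Real.log_div hb0.ne' ha.ne'] at h1 h2
  rw [inv_div] at h2
  have h0 : 0 ≤ 1 / a - 1 / b := by
    rw [sub_nonneg]; exact one_div_le_one_div_of_le ha hab
  have h3 : b / a - 1 - (1 - a / b) = (b - a) * (1 / a - 1 / b) := by field_simp
  have h4 : (b - a) * (1 / a - 1 / b) ≤ 1 * (1 / a - 1 / b) := by gcongr; linarith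
  rw [abs_le]
  constructor <;> linarith

theorem log_add_one_le_log_add_one {x : ℝ} (hx : 1 ≤ x) : log (x + 1) ≤ log x + 1 := by
  have h := Real.log_le_sub_one_of_pos (show 0 < (x + 1) / x by positivity)
  rw [Real.log_div (by positivity) (by positivity)] at h
  have h2 : (x + 1) / x - 1 ≤ 1 := by
    rw [sub_le_iff_le_add, div_le_iff₀ (by positivity)]; linarith
  linarith

theorem sum_primesLE_succ (f : ℕ → ℝ) (n : ℕ) :
    ∑ p ∈ (n + 1).primesLE, f p =
      ∑ p ∈ n.primesLE, f p + if (n + 1).Prime then f (n + 1) else 0 := by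
  rw [Nat.primesLE_eq_filter_range, Nat.primesLE_eq_filter_range, Finset.sum_filter,
    Finset.sum_filter, Finset.sum_range_succ]

/-- A real sequence whose increments are dominated by those of a sequence decreasing to `0`
converges, with the corresponding rate. -/
theorem exists_abs_sub_le_of_abs_succ_sub_le {E g : ℕ → ℝ}
    (hg : Filter.Tendsto g Filter.atTop (nhds 0))
    (h : ∀ n, |E (n + 1) - E n| ≤ g n - g (n + 1)) :
    ∃ M : ℝ, ∀ n, |E n - M| ≤ g n := by
  have hU : Antitone fun n => E n + g n := antitone_nat_of_succ_le fun n => by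
    linarith [(abs_le.1 (h n)).2]
  have hL : Monotone fun n => E n - g n := monotone_nat_of_le_succ fun n => by
    linarith [(abs_le.1 (h n)).1]
  have hg0 : ∀ n, 0 ≤ g n := fun n =>
    (antitone_nat_of_succ_le fun n => by linarith [(abs_nonneg _).trans (h n)] :
      Antitone g).le_of_tendsto hg n
  have hbdd : BddBelow (Set.range fun n => E n + g n) := by
    refine ⟨E 0 - g 0, ?_⟩
    rintro _ ⟨n, rfl⟩
    have := hL (Nat.zero_le n)
    dsimp only at this ⊢
    linarith [hg0 n]
  have hUM := tendsto_atTop_ciInf hU hbdd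
  set M := ⨅ n, E n + g n
  have hLM : Filter.Tendsto (fun n => E n - g n) Filter.atTop (nhds M) := by
    have := hUM.sub (hg.const_mul 2)
    simp only [mul_zero, sub_zero] at this
    exact this.congr fun n => by ring
  refine ⟨M, fun n => abs_le.2 ⟨?_, ?_⟩⟩
  · linarith [hU.le_of_tendsto hUM n]
  · linarith [hL.ge_of_tendsto hLM n]

theorem tendsto_const_div_log_natCast_atTop (K : ℝ) :
    Filter.Tendsto (fun n : ℕ => K / log n) Filter.atTop (nhds 0) :=
  (Real.tendsto_log_atTop.comp tendsto_natCast_atTop_atTop).const_div_atTop K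

/-- The second theorem of Mertens. -/
theorem exists_abs_sum_inv_primesLE_sub_log_log_sub_le :
    ∃ K M : ℝ, 0 < K ∧ ∀ N : ℕ, 2 ≤ N →
      |∑ p ∈ N.primesLE, 1 / (p : ℝ) - log (log N) - M| ≤ K / log N := by
  obtain ⟨K, hK, hA⟩ := exists_abs_sum_log_div_primesLE_sub_log_le
  set A : ℕ → ℝ := fun n => ∑ p ∈ n.primesLE, log p / p with hAdef
  set F : ℕ → ℝ := fun n => ∑ p ∈ n.primesLE, 1 / (p : ℝ) with hFdef
  have hl : ∀ n : ℕ, 2 ≤ n → 0 < log (n : ℝ) := fun n hn => Real.log_pos (by exact_mod_cast hn)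
  have hF : ∀ n : ℕ, 2 ≤ n → F (n + 1) - F n = (A (n + 1) - A n) / log (n + 1 : ℕ) := by
    intro n hn
    simp only [hFdef, hAdef, sum_primesLE_succ (fun p => 1 / (p : ℝ)),
      sum_primesLE_succ (fun p => log p / (p : ℝ))]
    have := (hl (n + 1) (by omega)).ne'
    split_ifs
    · rw [add_sub_cancel_left, add_sub_cancel_left]
      field_simp
    · simp
  have hE : ∀ n : ℕ, |(F (n + 1 + 2) - log (log (n + 1 + 2 : ℕ)) - A (n + 1 + 2) / log (n + 1 + 2 : ℕ))
      - (F (n + 2) - log (log (n + 2 : ℕ)) - A (n + 2) / log (n + 2 : ℕ))| ≤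
      (K + 1) / log (n + 2 : ℕ) - (K + 1) / log (n + 1 + 2 : ℕ) := by
    intro n
    obtain ⟨m, hm⟩ : ∃ m, m = n + 2 := ⟨_, rfl⟩
    rw [show n + 1 + 2 = m + 1 by omega, ← hm]
    have hm2 : 2 ≤ m := by omega
    have ha := hl m hm2
    have hb := hl (m + 1) (by omega)
    have hm1 : (1 : ℝ) ≤ m := by exact_mod_cast (by omega : 1 ≤ m)
    have hab : log m ≤ log (m + 1 : ℕ) := Real.log_le_log (by linarith) (by push_cast; linarith)
    have hb1 : log (m + 1 : ℕ) ≤ log m + 1 := by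
      push_cast; exact log_add_one_le_log_add_one hm1
    have h1 := abs_one_sub_div_sub_log_div_le ha hab hb1
    have h2 := hA m (by omega)
    have h3 := hF m hm2
    have h0 : 0 ≤ 1 / log (m : ℝ) - 1 / log (m + 1 : ℕ) := by
      rw [sub_nonneg]; exact one_div_le_one_div_of_le ha hab
    have e : (F (m + 1) - log (log (m + 1 : ℕ)) - A (m + 1) / log (m + 1 : ℕ))
        - (F m - log (log m) - A m / log m) =
        (1 - log m / log (m + 1 : ℕ) - (log (log (m + 1 : ℕ)) - log (log m))) +
        (A m - log m) * (1 / log (m : ℝ) - 1 / log (m + 1 : ℕ)) := by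
      have : F (m + 1) = F m + (A (m + 1) - A m) / log (m + 1 : ℕ) := by linarith
      rw [this]
      field_simp
      ring
    rw [e]
    refine (abs_add_le _ _).trans ?_
    rw [abs_mul, abs_of_nonneg h0]
    have h5 := mul_le_mul_of_nonneg_right h2 h0
    calc _ ≤ (1 / log (m : ℝ) - 1 / log (m + 1 : ℕ)) +
          K * (1 / log (m : ℝ) - 1 / log (m + 1 : ℕ)) := add_le_add h1 h5
      _ = _ := by ring
  obtain ⟨M, hM⟩ := exists_abs_sub_le_of_abs_succ_sub_le
    (E := fun n => F (n + 2) - log (log (n + 2 : ℕ)) - A (n + 2) / log (n + 2 : ℕ))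
    (g := fun n => (K + 1) / log (n + 2 : ℕ))
    ((Filter.tendsto_add_atTop_iff_nat 2).2 (tendsto_const_div_log_natCast_atTop (K + 1))) hE
  refine ⟨2 * K + 1, M + 1, by positivity, fun N hN => ?_⟩
  obtain ⟨n, rfl⟩ := Nat.exists_eq_add_of_le' hN
  have h1 := hM n
  have h2 := hA (n + 2) (by omega)
  have hlog := hl (n + 2) hN
  have e : F (n + 2) - log (log (n + 2 : ℕ)) - (M + 1) =
      (F (n + 2) - log (log (n + 2 : ℕ)) - A (n + 2) / log (n + 2 : ℕ) - M) +
      (A (n + 2) - log (n + 2 : ℕ)) / log (n + 2 : ℕ) := by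
    field_simp
    ring
  have h3 : |(A (n + 2) - log (n + 2 : ℕ)) / log (n + 2 : ℕ)| ≤ K / log (n + 2 : ℕ) := by
    rw [abs_div, abs_of_pos hlog]
    gcongr
  change |F (n + 2) - log (log (n + 2 : ℕ)) - (M + 1)| ≤ _
  rw [e]
  refine (abs_add_le _ _).trans ((add_le_add h1 h3).trans (le_of_eq ?_))
  ring

theorem integral_exp_neg_mul_tsum_ite {ι : Type*} [Countable ι] (a c : ι → ℝ)
    (hc : ∀ i, 0 ≤ c i) (h : Summable fun i => |a i| * exp (-c i)) :
    ∫ v in Set.Ici (0 : ℝ), exp (-v) * ∑' i, (if c i ≤ v then a i else 0) =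
      ∑' i, a i * exp (-c i) := by
  have key : ∀ (b : ℝ) (i : ι),
      ∫ v in Set.Ici (0 : ℝ), (Set.Ici (c i)).indicator (fun v => b * exp (-v)) v =
        b * exp (-c i) := by
    intro b i
    rw [MeasureTheory.setIntegral_indicator measurableSet_Ici, Set.inter_eq_self_of_subset_right
      (Set.Ici_subset_Ici.2 (hc i)), MeasureTheory.integral_const_mul,
      MeasureTheory.integral_Ici_eq_integral_Ioi, integral_exp_neg_Ioi]
  have hint : ∀ i, MeasureTheory.Integrable
      ((Set.Ici (c i)).indicator (fun v => a i * exp (-v)))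
      (MeasureTheory.volume.restrict (Set.Ici (0 : ℝ))) := fun i =>
    (((integrableOn_Ici_iff_integrableOn_Ioi).2 (integrableOn_exp_neg_Ioi 0)).const_mul
      (a i)).indicator measurableSet_Ici
  have hnorm : ∀ i, ∫ v in Set.Ici (0 : ℝ),
      ‖(Set.Ici (c i)).indicator (fun v => a i * exp (-v)) v‖ = |a i| * exp (-c i) := by
    intro i
    rw [← key |a i| i]
    congr 1 with v
    rw [norm_indicator_eq_indicator_norm]
    simp
  have := MeasureTheory.integral_tsum_of_summable_integral_norm hint (by simpa only [hnorm] using h)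
  simp only [key] at this
  rw [this]
  congr 1 with v
  rw [← tsum_mul_left]
  congr 1 with i
  simp only [Set.indicator_apply, Set.mem_Ici, mul_ite, mul_zero, mul_comm (a i)]

theorem tendsto_integral_exp_neg_mul_comp_div {D : ℝ → ℝ} {C L : ℝ} (hD : Measurable D)
    (hC : ∀ u, 0 ≤ u → |D u| ≤ C) (hL : Filter.Tendsto D Filter.atTop (nhds L)) :
    Filter.Tendsto (fun s : ℝ => ∫ v in Set.Ici (0 : ℝ), exp (-v) * D (v / s))
      (nhdsWithin 0 (Set.Ioi 0)) (nhds L) := by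
  simp only [MeasureTheory.integral_Ici_eq_integral_Ioi]
  have hlim : ∫ v in Set.Ioi (0 : ℝ), exp (-v) * L = L := by
    rw [MeasureTheory.integral_mul_const, integral_exp_neg_Ioi_zero, one_mul]
  rw [← hlim]
  refine MeasureTheory.tendsto_integral_filter_of_dominated_convergence
    (fun v => exp (-v) * C) ?_ ?_ ((integrableOn_exp_neg_Ioi 0).mul_const C) ?_
  · exact Filter.Eventually.of_forall fun s => (by fun_prop : Measurable _).aestronglyMeasurable
  · filter_upwards [self_mem_nhdsWithin] with s hs
    filter_upwards [MeasureTheory.ae_restrict_mem measurableSet_Ioi] with v hv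
    rw [norm_mul, Real.norm_of_nonneg (exp_pos _).le]
    exact mul_le_mul_of_nonneg_left (hC _ (div_nonneg (le_of_lt hv) (le_of_lt hs))) (exp_pos _).le
  · filter_upwards [MeasureTheory.ae_restrict_mem measurableSet_Ioi] with v hv
    exact (hL.comp (tendsto_inv_nhdsGT_zero.const_mul_atTop hv)).const_mul _

theorem tendsto_log_natFloor_sub_log_atTop :
    Filter.Tendsto (fun x : ℝ => log (⌊x⌋₊ : ℝ) - log x) Filter.atTop (nhds 0) := by
  have h : Filter.Tendsto (fun x : ℝ => log ((⌊x⌋₊ : ℝ) / x)) Filter.atTop (nhds (log 1)) :=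
    (Real.continuousAt_log one_ne_zero).tendsto.comp tendsto_nat_floor_div_atTop
  rw [Real.log_one] at h
  refine h.congr' ?_
  filter_upwards [Filter.eventually_ge_atTop 1] with x hx
  have : 0 < ⌊x⌋₊ := Nat.floor_pos.2 hx
  rw [Real.log_div (by positivity) (by positivity)]

theorem tendsto_harmonic_floor_sub_log :
    Filter.Tendsto (fun x : ℝ => (harmonic ⌊x⌋₊ : ℝ) - log x) Filter.atTop
      (nhds eulerMascheroniConstant) := by
  have h := (Real.tendsto_harmonic_sub_log.comp tendsto_nat_floor_atTop).add
    tendsto_log_natFloor_sub_log_atTop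
  rw [add_zero] at h
  exact h.congr fun x => by simp

theorem tendsto_log_log_natFloor_exp_sub_log :
    Filter.Tendsto (fun u : ℝ => log (log (⌊exp u⌋₊ : ℝ)) - log u) Filter.atTop (nhds 0) := by
  have h1 : Filter.Tendsto (fun u : ℝ => log (⌊exp u⌋₊ : ℝ) - u) Filter.atTop (nhds 0) :=
    (tendsto_log_natFloor_sub_log_atTop.comp Real.tendsto_exp_atTop).congr fun u => by simp
  have h2 : Filter.Tendsto (fun u : ℝ => 1 + (log (⌊exp u⌋₊ : ℝ) - u) / u) Filter.atTop
      (nhds 1) := by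
    simpa using (h1.div_atTop Filter.tendsto_id).const_add 1
  have h3 := (Real.continuousAt_log one_ne_zero).tendsto.comp h2
  rw [Real.log_one] at h3
  refine h3.congr' ?_
  filter_upwards [Filter.eventually_ge_atTop 1] with u hu
  have h4 : 2 ≤ ⌊exp u⌋₊ := Nat.le_floor (by push_cast; linarith [Real.add_one_le_exp u])
  have h5 : 0 < log (⌊exp u⌋₊ : ℝ) := Real.log_pos (by exact_mod_cast h4)
  rw [← Real.log_div h5.ne' (by linarith)]
  simp only [Function.comp]
  congr 1
  field_simp
  ring

theorem tendsto_sum_inv_primesLE_sub_harmonic {K M : ℝ}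
    (hM : ∀ N : ℕ, 2 ≤ N →
      |∑ p ∈ N.primesLE, 1 / (p : ℝ) - log (log N) - M| ≤ K / log N) :
    Filter.Tendsto (fun u : ℝ => ∑ p ∈ Nat.primesLE ⌊exp u⌋₊, 1 / (p : ℝ) - (harmonic ⌊u⌋₊ : ℝ))
      Filter.atTop (nhds (M - eulerMascheroniConstant)) := by
  have h1 : Filter.Tendsto (fun N : ℕ => ∑ p ∈ N.primesLE, 1 / (p : ℝ) - log (log N) - M)
      Filter.atTop (nhds 0) := by
    refine squeeze_zero_norm' ?_ (tendsto_const_div_log_natCast_atTop K)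
    filter_upwards [Filter.eventually_ge_atTop 2] with N hN using hM N hN
  have h2 := h1.comp (tendsto_nat_floor_atTop.comp Real.tendsto_exp_atTop)
  have h3 := ((h2.add tendsto_log_log_natFloor_exp_sub_log).sub
    tendsto_harmonic_floor_sub_log).add_const M
  rw [show (0 : ℝ) + 0 - eulerMascheroniConstant + M = M - eulerMascheroniConstant by ring] at h3
  exact h3.congr fun u => by simp only [Function.comp]; ring

theorem sum_inv_primesLE_mono {m n : ℕ} (h : m ≤ n) :
    ∑ p ∈ m.primesLE, 1 / (p : ℝ) ≤ ∑ p ∈ n.primesLE, 1 / (p : ℝ) :=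
  Finset.sum_le_sum_of_subset_of_nonneg (Nat.primesLE_mono h) fun _ _ _ => by positivity

theorem harmonic_eq_sum_real (n : ℕ) :
    (harmonic n : ℝ) = ∑ i ∈ Finset.range n, 1 / ((i : ℝ) + 1) := by
  simp [harmonic]

theorem exists_abs_sum_inv_primesLE_sub_harmonic_le {L : ℝ}
    (h : Filter.Tendsto
      (fun u : ℝ => ∑ p ∈ Nat.primesLE ⌊exp u⌋₊, 1 / (p : ℝ) - (harmonic ⌊u⌋₊ : ℝ))
      Filter.atTop (nhds L)) :
    ∃ C : ℝ, ∀ u : ℝ,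
      |∑ p ∈ Nat.primesLE ⌊exp u⌋₊, 1 / (p : ℝ) - (harmonic ⌊u⌋₊ : ℝ)| ≤ C := by
  obtain ⟨U, hU⟩ := Filter.eventually_atTop.1
    (h.abs.eventually (eventually_le_nhds (lt_add_one |L|)))
  refine ⟨max (|L| + 1) (∑ p ∈ Nat.primesLE ⌊exp U⌋₊, 1 / (p : ℝ) + (harmonic ⌊U⌋₊ : ℝ)),
    fun u => ?_⟩
  rcases le_total U u with hu | hu
  · exact (hU u hu).trans (le_max_left _ _)
  · refine le_trans ?_ (le_max_right _ _)
    have h1 : 0 ≤ ∑ p ∈ Nat.primesLE ⌊exp u⌋₊, 1 / (p : ℝ) :=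
      Finset.sum_nonneg fun _ _ => by positivity
    have h2 : (0 : ℝ) ≤ harmonic ⌊u⌋₊ := by
      rw [harmonic_eq_sum_real]; exact Finset.sum_nonneg fun _ _ => by positivity
    have h3 := sum_inv_primesLE_mono (Nat.floor_le_floor (Real.exp_le_exp.2 hu))
    have h4 : (harmonic ⌊u⌋₊ : ℝ) ≤ harmonic ⌊U⌋₊ := by
      rw [harmonic_eq_sum_real, harmonic_eq_sum_real]
      exact Finset.sum_le_sum_of_subset_of_nonneg
        (Finset.range_subset_range.2 (Nat.floor_le_floor hu)) fun _ _ _ => by positivity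
    rw [abs_le]
    constructor <;> linarith

theorem hasSum_primes_ite {s v : ℝ} (hs : 0 < s) :
    HasSum (fun p : Nat.Primes => if s * log (p : ℕ) ≤ v then 1 / ((p : ℕ) : ℝ) else 0)
      (∑ p ∈ Nat.primesLE ⌊exp (v / s)⌋₊, 1 / (p : ℝ)) := by
  refine (hasSum_subtype_iff_indicator (s := {p : ℕ | p.Prime})
    (f := fun n : ℕ => if s * log n ≤ v then 1 / (n : ℝ) else 0)).2 ?_
  have hiff : ∀ n : ℕ, n.Prime → (s * log n ≤ v ↔ n ≤ ⌊exp (v / s)⌋₊) := fun n hn => by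
    rw [Nat.le_floor_iff (exp_pos _).le, ← Real.log_le_iff_le_exp (by exact_mod_cast hn.pos),
      le_div_iff₀ hs, mul_comm]
  have h := hasSum_sum_of_ne_finset_zero (L := SummationFilter.unconditional ℕ)
    (s := Nat.primesLE ⌊exp (v / s)⌋₊)
    (f := {p : ℕ | p.Prime}.indicator fun n : ℕ => if s * log n ≤ v then 1 / (n : ℝ) else 0)
    (fun n hn => by
      by_cases hp : n.Prime
      · have : ¬ s * log n ≤ v := fun h => hn (Nat.mem_primesLE.2 ⟨(hiff n hp).1 h, hp⟩)
        simp [this]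
      · simp [hp])
  convert! h using 1
  refine Finset.sum_congr rfl fun n hn => ?_
  obtain ⟨h1, h2⟩ := Nat.mem_primesLE.1 hn
  simp [h2, (hiff n h2).2 h1]

theorem hasSum_harmonic_ite {s v : ℝ} (hs : 0 < s) (hv : 0 ≤ v) :
    HasSum (fun n : ℕ => if s * ((n : ℝ) + 1) ≤ v then -(1 / ((n : ℝ) + 1)) else 0)
      (-(harmonic ⌊v / s⌋₊ : ℝ)) := by
  have hiff : ∀ n : ℕ, s * ((n : ℝ) + 1) ≤ v ↔ n < ⌊v / s⌋₊ := fun n => by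
    rw [← Nat.succ_le_iff, Nat.le_floor_iff (by positivity), le_div_iff₀ hs, mul_comm]
    push_cast
    rfl
  simp only [hiff]
  rw [harmonic_eq_sum_real, ← Finset.sum_neg_distrib]
  have h := hasSum_sum_of_ne_finset_zero (L := SummationFilter.unconditional ℕ)
    (s := Finset.range ⌊v / s⌋₊)
    (f := fun n : ℕ => if n < ⌊v / s⌋₊ then -(1 / ((n : ℝ) + 1)) else 0)
    (fun n hn => if_neg fun h => hn (Finset.mem_range.2 h))
  convert! h using 1
  exact Finset.sum_congr rfl fun n hn => (if_pos (Finset.mem_range.1 hn)).symm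

theorem tendsto_tsum_primes_rpow_add_log {K M : ℝ}
    (hM : ∀ N : ℕ, 2 ≤ N →
      |∑ p ∈ N.primesLE, 1 / (p : ℝ) - log (log N) - M| ≤ K / log N) :
    Filter.Tendsto (fun s : ℝ => ∑' p : Nat.Primes, ((p : ℕ) : ℝ) ^ (-(1 + s)) +
      log (1 - exp (-s))) (nhdsWithin 0 (Set.Ioi 0)) (nhds (M - eulerMascheroniConstant)) := by
  have hlim := tendsto_sum_inv_primesLE_sub_harmonic hM
  obtain ⟨C, hC⟩ := exists_abs_sum_inv_primesLE_sub_harmonic_le hlim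
  have hmeas : Measurable
      (fun u : ℝ => ∑ p ∈ Nat.primesLE ⌊exp u⌋₊, 1 / (p : ℝ) - (harmonic ⌊u⌋₊ : ℝ)) := by
    refine Measurable.sub ?_ ?_
    · exact (measurable_from_nat (f := fun N => ∑ p ∈ Nat.primesLE N, 1 / (p : ℝ))).comp
        (Nat.measurable_floor.comp Real.measurable_exp)
    · exact (measurable_from_nat (f := fun N => (harmonic N : ℝ))).comp Nat.measurable_floor
  refine (tendsto_integral_exp_neg_mul_comp_div hmeas (fun u _ => hC u) hlim).congr' ?_
  filter_upwards [self_mem_nhdsWithin] with s hs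
  have hs : 0 < s := hs
  let a : Nat.Primes ⊕ ℕ → ℝ :=
    Sum.elim (fun p => 1 / ((p : ℕ) : ℝ)) (fun n => -(1 / ((n : ℝ) + 1)))
  let c : Nat.Primes ⊕ ℕ → ℝ := Sum.elim (fun p => s * log (p : ℕ)) (fun n => s * ((n : ℝ) + 1))
  have hc : ∀ i, 0 ≤ c i := by
    rintro (p | n)
    · exact mul_nonneg hs.le (Real.log_natCast_nonneg _)
    · simp only [c, Sum.elim_inr]; positivity
  have hP : HasSum (fun p : Nat.Primes => 1 / ((p : ℕ) : ℝ) * exp (-(s * log (p : ℕ))))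
      (∑' p : Nat.Primes, ((p : ℕ) : ℝ) ^ (-(1 + s))) := by
    convert! (Nat.Primes.summable_rpow.2 (by linarith : -(1 + s) < -1)).hasSum using 2 with p
    have hp : (0 : ℝ) < (p : ℕ) := by exact_mod_cast p.2.pos
    rw [Real.rpow_def_of_pos hp, show log (p : ℕ) * -(1 + s) =
      -log (p : ℕ) + -(s * log (p : ℕ)) by ring, Real.exp_add]
    congr 1
    rw [Real.exp_neg, Real.exp_log hp, one_div]
  have hL : HasSum (fun n : ℕ => 1 / ((n : ℝ) + 1) * exp (-(s * ((n : ℝ) + 1))))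
      (-log (1 - exp (-s))) := by
    convert! Real.hasSum_pow_div_log_of_abs_lt_one (x := exp (-s)) ?_ using 2 with n
    · rw [← Real.exp_nat_mul]
      push_cast
      rw [show ((n : ℝ) + 1) * -s = -(s * ((n : ℝ) + 1)) by ring]
      ring
    · rw [abs_of_pos (exp_pos _)]
      exact Real.exp_lt_one_iff.2 (by linarith)
  have hsum : HasSum (fun i => a i * exp (-c i)) (∑' p : Nat.Primes, ((p : ℕ) : ℝ) ^ (-(1 + s)) +
      log (1 - exp (-s))) := by
    refine HasSum.sum hP ?_
    convert! hL.neg using 1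
    · funext n
      simp only [Function.comp, a, c, Sum.elim_inr, neg_mul]
    · rw [neg_neg]
  rw [← hsum.tsum_eq, ← integral_exp_neg_mul_tsum_ite a c hc]
  · refine MeasureTheory.setIntegral_congr_fun measurableSet_Ici fun v hv => ?_
    have h : HasSum (fun i => if c i ≤ v then a i else 0)
        (∑ p ∈ Nat.primesLE ⌊exp (v / s)⌋₊, 1 / (p : ℝ) + -(harmonic ⌊v / s⌋₊ : ℝ)) := by
      refine HasSum.sum ?_ ?_
      · convert! hasSum_primes_ite hs using 1
      · convert! hasSum_harmonic_ite hs hv using 1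
    simp only [h.tsum_eq, sub_eq_add_neg]
  · have := hsum.summable.abs
    refine this.congr fun i => ?_
    rw [abs_mul, abs_of_pos (exp_pos _)]

theorem abs_neg_log_one_sub_sub_le {x : ℝ} (h0 : 0 ≤ x) (h1 : x ≤ 1 / 2) :
    |-log (1 - x) - x| ≤ 2 * x ^ 2 := by
  have h := Real.abs_log_sub_add_sum_range_le (x := x) (by rw [abs_of_nonneg h0]; linarith) 1
  simp only [Finset.range_one, Finset.sum_singleton, zero_add, pow_one, Nat.cast_zero, div_one,
    abs_of_nonneg h0] at h
  rw [show -log (1 - x) - x = -(x + log (1 - x)) by ring, abs_neg]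
  refine h.trans ?_
  rw [div_le_iff₀ (by linarith)]
  norm_num
  nlinarith [sq_nonneg x]

theorem natPrimes_rpow_neg_one_add_le {s : ℝ} (hs : 0 ≤ s) (p : Nat.Primes) :
    ((p : ℕ) : ℝ) ^ (-(1 + s)) ≤ 1 / ((p : ℕ) : ℝ) := by
  have h1 : (1 : ℝ) ≤ (p : ℕ) := by exact_mod_cast p.2.one_le
  rw [one_div, ← Real.rpow_neg_one]
  exact Real.rpow_le_rpow_of_exponent_le h1 (by linarith)

theorem one_div_natPrimes_le (p : Nat.Primes) : 1 / ((p : ℕ) : ℝ) ≤ 1 / 2 :=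
  one_div_le_one_div_of_le (by norm_num) (by exact_mod_cast p.2.two_le)

theorem abs_euler_log_remainder_le {s : ℝ} (hs : 0 ≤ s) (p : Nat.Primes) :
    |-log (1 - ((p : ℕ) : ℝ) ^ (-(1 + s))) - ((p : ℕ) : ℝ) ^ (-(1 + s))| ≤
      2 * ((p : ℕ) : ℝ) ^ (-2 : ℝ) := by
  have h0 : (0 : ℝ) ≤ ((p : ℕ) : ℝ) ^ (-(1 + s)) := Real.rpow_nonneg (Nat.cast_nonneg _) _
  have h1 := natPrimes_rpow_neg_one_add_le hs p
  refine (abs_neg_log_one_sub_sub_le h0 (h1.trans (one_div_natPrimes_le p))).trans ?_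
  have h2 : ((p : ℕ) : ℝ) ^ (-2 : ℝ) = (1 / ((p : ℕ) : ℝ)) ^ 2 := by
    rw [Real.rpow_neg (Nat.cast_nonneg _), one_div, inv_pow]
    norm_num
  rw [h2]
  gcongr

theorem summable_two_mul_natPrimes_rpow :
    Summable fun p : Nat.Primes => 2 * ((p : ℕ) : ℝ) ^ (-2 : ℝ) :=
  (Nat.Primes.summable_rpow.2 (by norm_num)).mul_left 2

theorem hasProd_primes_one_sub_rpow_inv {t : ℝ} (ht : 1 < t) :
    HasProd (fun p : Nat.Primes => (1 - ((p : ℕ) : ℝ) ^ (-t))⁻¹) (∑' n : ℕ, 1 / (n : ℝ) ^ t) := by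
  let f : ℕ →*₀ ℝ :=
    { toFun := fun n => (n : ℝ) ^ (-t)
      map_zero' := by simp [Real.zero_rpow (by linarith : -t ≠ 0)]
      map_one' := by simp
      map_mul' := fun m n => by
        push_cast
        exact Real.mul_rpow (Nat.cast_nonneg _) (Nat.cast_nonneg _) }
  have hf : ∀ n : ℕ, f n = 1 / (n : ℝ) ^ t := fun n => by
    change (n : ℝ) ^ (-t) = _
    rw [Real.rpow_neg (Nat.cast_nonneg _), one_div]
  have hsum : Summable fun n => ‖f n‖ := by
    simp only [hf]
    exact (Real.summable_one_div_nat_rpow.2 ht).norm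
  have h := EulerProduct.eulerProduct_completely_multiplicative_hasProd hsum
  simp only [hf] at h
  simpa only [Real.rpow_neg (Nat.cast_nonneg _), one_div] using h

theorem tsum_euler_log_remainder_add_tsum_primes_rpow {s : ℝ} (hs : 0 < s) :
    ∑' p : Nat.Primes,
        (-log (1 - ((p : ℕ) : ℝ) ^ (-(1 + s))) - ((p : ℕ) : ℝ) ^ (-(1 + s))) +
      ∑' p : Nat.Primes, ((p : ℕ) : ℝ) ^ (-(1 + s)) = log (∑' n : ℕ, 1 / (n : ℝ) ^ (1 + s)) := by
  have h1 : Summable fun p : Nat.Primes =>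
      -log (1 - ((p : ℕ) : ℝ) ^ (-(1 + s))) - ((p : ℕ) : ℝ) ^ (-(1 + s)) :=
    Summable.of_norm_bounded summable_two_mul_natPrimes_rpow
      fun p => abs_euler_log_remainder_le hs.le p
  have h2 : Summable fun p : Nat.Primes => ((p : ℕ) : ℝ) ^ (-(1 + s)) :=
    Nat.Primes.summable_rpow.2 (by linarith)
  have h3 := (h1.hasSum.add h2.hasSum).rexp
  have h4 : (rexp ∘ fun p : Nat.Primes =>
      -log (1 - ((p : ℕ) : ℝ) ^ (-(1 + s))) - ((p : ℕ) : ℝ) ^ (-(1 + s)) +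
        ((p : ℕ) : ℝ) ^ (-(1 + s))) =
      fun p : Nat.Primes => (1 - ((p : ℕ) : ℝ) ^ (-(1 + s)))⁻¹ := by
    funext p
    have := (natPrimes_rpow_neg_one_add_le hs.le p).trans (one_div_natPrimes_le p)
    simp only [Function.comp, sub_add_cancel]
    rw [Real.exp_neg, Real.exp_log (by linarith)]
  rw [h4] at h3
  rw [(hasProd_primes_one_sub_rpow_inv (by linarith : 1 < 1 + s)).unique h3, Real.log_exp]

theorem tendsto_tsum_euler_log_remainder :
    Filter.Tendsto (fun s : ℝ => ∑' p : Nat.Primes,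
        (-log (1 - ((p : ℕ) : ℝ) ^ (-(1 + s))) - ((p : ℕ) : ℝ) ^ (-(1 + s))))
      (nhdsWithin 0 (Set.Ioi 0))
      (nhds (∑' p : Nat.Primes, (-log (1 - 1 / ((p : ℕ) : ℝ)) - 1 / ((p : ℕ) : ℝ)))) := by
  refine tendsto_tsum_of_dominated_convergence summable_two_mul_natPrimes_rpow (fun p => ?_) ?_
  · have hp : (0 : ℝ) < (p : ℕ) := by exact_mod_cast p.2.pos
    have h1 : Filter.Tendsto (fun s : ℝ => ((p : ℕ) : ℝ) ^ (-(1 + s))) (nhdsWithin 0 (Set.Ioi 0))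
        (nhds (1 / ((p : ℕ) : ℝ))) := by
      have : Continuous fun s : ℝ => ((p : ℕ) : ℝ) ^ (-(1 + s)) :=
        Continuous.rpow continuous_const (by fun_prop) fun _ => Or.inl hp.ne'
      have h := (this.tendsto 0).mono_left (nhdsWithin_le_nhds (s := Set.Ioi 0))
      simpa [Real.rpow_neg_one] using h
    have h2 : 1 - 1 / ((p : ℕ) : ℝ) ≠ 0 := by linarith [one_div_natPrimes_le p]
    exact (((h1.const_sub 1).log h2).neg).sub h1
  · filter_upwards [self_mem_nhdsWithin] with s hs p
    exact abs_euler_log_remainder_le (le_of_lt hs) p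

theorem tendsto_log_tsum_add_log_one_sub_exp :
    Filter.Tendsto (fun s : ℝ => log (∑' n : ℕ, 1 / (n : ℝ) ^ (1 + s)) + log (1 - exp (-s)))
      (nhdsWithin 0 (Set.Ioi 0)) (nhds 0) := by
  have h1 : Filter.Tendsto (fun s : ℝ => s * ∑' n : ℕ, 1 / (n : ℝ) ^ (1 + s))
      (nhdsWithin 0 (Set.Ioi 0)) (nhds 1) := by
    have hmap : Filter.Tendsto (fun s : ℝ => 1 + s) (nhdsWithin 0 (Set.Ioi 0))
        (nhdsWithin 1 (Set.Ioi 1)) := by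
      refine tendsto_nhdsWithin_iff.2 ⟨?_, ?_⟩
      · have : Filter.Tendsto (fun s : ℝ => 1 + s) (nhds 0) (nhds (1 + 0)) :=
          (continuous_const.add continuous_id).tendsto 0
        rw [add_zero] at this
        exact this.mono_left nhdsWithin_le_nhds
      · filter_upwards [self_mem_nhdsWithin] with s hs
        have hs : 0 < s := hs
        simpa using hs
    exact (tendsto_sub_mul_tsum_nat_rpow.comp hmap).congr fun s => by simp
  have h2 : Filter.Tendsto (fun s : ℝ => (1 - exp (-s)) / s) (nhdsWithin 0 (Set.Ioi 0))
      (nhds 1) := by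
    have hd : HasDerivAt (fun s : ℝ => 1 - exp (-s)) 1 0 := by
      have := ((hasDerivAt_neg (0 : ℝ)).exp).const_sub 1
      simpa using this
    have := (hasDerivAt_iff_tendsto_slope.1 hd).mono_left
      (nhdsWithin_mono 0 (fun x hx => ne_of_gt hx : Set.Ioi (0 : ℝ) ⊆ {0}ᶜ))
    refine this.congr fun s => ?_
    simp [slope_def_field]
  have h3 := (h1.mul h2).log (by norm_num)
  rw [mul_one, Real.log_one] at h3
  refine h3.congr' ?_
  filter_upwards [self_mem_nhdsWithin] with s hs
  have hs : 0 < s := hs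
  have he : 0 < 1 - exp (-s) := by
    linarith [Real.exp_lt_one_iff.2 (by linarith : -s < 0)]
  have hZ : 0 < ∑' n : ℕ, 1 / (n : ℝ) ^ (1 + s) := by
    have hsum := Real.summable_one_div_nat_rpow.2 (by linarith : 1 < 1 + s)
    exact hsum.tsum_pos (fun n => by positivity) 1 (by norm_num)
  rw [← Real.log_mul hZ.ne' he.ne']
  congr 1
  field_simp

/-- The constant in the third theorem of Mertens is Euler's constant. -/
theorem mertens_constant_eq {K M : ℝ}
    (hM : ∀ N : ℕ, 2 ≤ N →
      |∑ p ∈ N.primesLE, 1 / (p : ℝ) - log (log N) - M| ≤ K / log N) :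
    ∑' p : Nat.Primes, (-log (1 - 1 / ((p : ℕ) : ℝ)) - 1 / ((p : ℕ) : ℝ)) + M =
      eulerMascheroniConstant := by
  have h1 := tendsto_tsum_euler_log_remainder.add (tendsto_tsum_primes_rpow_add_log hM)
  have h2 : Filter.Tendsto (fun s : ℝ => log (∑' n : ℕ, 1 / (n : ℝ) ^ (1 + s)) +
      log (1 - exp (-s))) (nhdsWithin 0 (Set.Ioi 0)) (nhds
        (∑' p : Nat.Primes, (-log (1 - 1 / ((p : ℕ) : ℝ)) - 1 / ((p : ℕ) : ℝ)) +
          (M - eulerMascheroniConstant))) := by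
    refine h1.congr' ?_
    filter_upwards [self_mem_nhdsWithin] with s hs
    rw [← tsum_euler_log_remainder_add_tsum_primes_rpow hs]
    ring
  linarith [tendsto_nhds_unique h2 tendsto_log_tsum_add_log_one_sub_exp]

theorem abs_sum_euler_log_remainder_sub_le (N : ℕ) (hN : 1 ≤ N) :
    |∑ p ∈ N.primesLE, (-log (1 - 1 / (p : ℝ)) - 1 / (p : ℝ)) -
      ∑' p : Nat.Primes, (-log (1 - 1 / ((p : ℕ) : ℝ)) - 1 / ((p : ℕ) : ℝ))| ≤ 2 / N := by
  set c : ℕ → ℝ := fun n => -log (1 - 1 / (n : ℝ)) - 1 / (n : ℝ) with hc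
  set E : ℕ → ℝ := fun N => ∑ p ∈ N.primesLE, c p with hEdef
  have hcb : ∀ n : ℕ, n.Prime → |c n| ≤ 2 * (1 / (n : ℝ)) ^ 2 := fun n hn =>
    abs_neg_log_one_sub_sub_le (by positivity) (one_div_natPrimes_le ⟨n, hn⟩)
  have hE : ∀ n : ℕ, |E (n + 1 + 1) - E (n + 1)| ≤
      2 / ((n + 1 : ℕ) : ℝ) - 2 / ((n + 1 + 1 : ℕ) : ℝ) := by
    intro n
    simp only [hEdef, sum_primesLE_succ c (n + 1), add_sub_cancel_left]
    have h0 : 2 * (1 / ((n + 1 + 1 : ℕ) : ℝ)) ^ 2 ≤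
        2 / ((n + 1 : ℕ) : ℝ) - 2 / ((n + 1 + 1 : ℕ) : ℝ) := by
      push_cast
      rw [div_sub_div _ _ (by positivity) (by positivity), div_pow, mul_div_assoc',
        div_le_div_iff₀ (by positivity) (by positivity)]
      ring_nf
      nlinarith [(Nat.cast_nonneg n : (0 : ℝ) ≤ n)]
    split_ifs with hp
    · exact (hcb _ hp).trans h0
    · rw [abs_zero]
      exact le_trans (by positivity) h0
  have hg : Filter.Tendsto (fun n : ℕ => 2 / ((n + 1 : ℕ) : ℝ)) Filter.atTop (nhds 0) :=
    (Filter.tendsto_add_atTop_iff_nat (f := fun n : ℕ => 2 / (n : ℝ)) 1).2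
      (tendsto_const_div_atTop_nhds_zero_nat 2)
  obtain ⟨M, hM⟩ := exists_abs_sub_le_of_abs_succ_sub_le (E := fun n => E (n + 1)) hg hE
  have hEM : Filter.Tendsto E Filter.atTop (nhds M) := by
    rw [← Filter.tendsto_add_atTop_iff_nat 1, tendsto_iff_norm_sub_tendsto_zero]
    exact squeeze_zero (fun _ => norm_nonneg _) hM hg
  have hsum : Summable fun p : Nat.Primes => c p := by
    refine Summable.of_norm_bounded summable_two_mul_natPrimes_rpow fun p => ?_
    have := abs_euler_log_remainder_le le_rfl p
    simp only [add_zero, Real.rpow_neg_one, ← one_div] at this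
    exact this
  have hB : Filter.Tendsto E Filter.atTop (nhds (∑' p : Nat.Primes, c p)) := by
    have h1 := ((hasSum_subtype_iff_indicator (s := {p : ℕ | p.Prime}) (f := c)).1
      hsum.hasSum).tendsto_sum_nat
    refine (h1.comp (Filter.tendsto_add_atTop_nat 1)).congr fun n => ?_
    simp only [hEdef, Function.comp, Nat.primesLE_eq_filter_range, Finset.sum_filter,
      Set.indicator_apply, Set.mem_ofPred_eq]
  rw [tendsto_nhds_unique hB hEM]
  obtain ⟨n, rfl⟩ := Nat.exists_eq_add_of_le' hN
  exact hM n

theorem abs_exp_sub_one_le_mul_exp_abs (x : ℝ) : |exp x - 1| ≤ |x| * exp |x| := by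
  rcases le_total 0 x with h | h
  · rw [abs_of_nonneg h, abs_of_nonneg (by linarith [Real.add_one_le_exp x])]
    have h1 := Real.add_one_le_exp (-x)
    have h2 : exp (-x) * exp x = 1 := by rw [← Real.exp_add]; simp
    nlinarith [Real.exp_pos x]
  · rw [abs_of_nonpos h, abs_of_nonpos (by linarith [Real.exp_le_one_iff.2 h])]
    have h1 := Real.add_one_le_exp x
    have h2 : 1 ≤ exp (-x) := Real.one_le_exp_iff.2 (by linarith)
    nlinarith

theorem prod_primesLE_inv_eq_exp (N : ℕ) :
    ∏ p ∈ N.primesLE, (1 - 1 / (p : ℝ))⁻¹ = exp (∑ p ∈ N.primesLE, -log (1 - 1 / (p : ℝ))) := by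
  rw [Real.exp_sum]
  refine Finset.prod_congr rfl fun p hp => ?_
  have := one_div_natPrimes_le ⟨p, Nat.prime_of_mem_primesLE hp⟩
  simp only at this
  rw [Real.exp_neg, Real.exp_log (by linarith)]

/-- The third theorem of Mertens. -/
theorem exists_abs_prod_primesLE_inv_sub_le :
    ∃ C, 0 < C ∧ ∀ N : ℕ, 1 ≤ N →
      |∏ p ∈ N.primesLE, (1 - 1 / (p : ℝ))⁻¹ - exp eulerMascheroniConstant * log N| ≤ C := by
  obtain ⟨K, M, hK, hM⟩ := exists_abs_sum_inv_primesLE_sub_log_log_sub_le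
  set K' := K + 2 with hK'
  have hl2 : 0 < log 2 := Real.log_pos (by norm_num)
  refine ⟨exp eulerMascheroniConstant * (K' * exp (K' / log 2)) + 1, by positivity,
    fun N hN => ?_⟩
  rcases hN.eq_or_lt with rfl | hN2
  · have : Nat.primesLE 1 = ∅ := by decide
    rw [this]
    simp only [Finset.prod_empty, Nat.cast_one, Real.log_one, mul_zero, sub_zero, abs_one]
    have : 0 ≤ exp eulerMascheroniConstant * (K' * exp (K' / log 2)) := by positivity
    linarith
  have hN2 : 2 ≤ N := hN2
  have hN2' : (2 : ℝ) ≤ N := by exact_mod_cast hN2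
  have hL2 : log 2 ≤ log N := Real.log_le_log (by norm_num) hN2'
  have hL : 0 < log N := hl2.trans_le hL2
  have hLN : log N ≤ N := (Real.log_le_sub_one_of_pos (by linarith)).trans (by linarith)
  set δ := ∑ p ∈ N.primesLE, -log (1 - 1 / (p : ℝ)) - log (log N) - eulerMascheroniConstant with hδ
  have hδb : |δ| ≤ K' / log N := by
    have h1 := hM N hN2
    have h2 := abs_sum_euler_log_remainder_sub_le N hN
    have h3 : (2 : ℝ) / N ≤ 2 / log N := by gcongr
    rw [Finset.sum_sub_distrib] at h2
    rw [hδ, ← mertens_constant_eq hM, hK', add_div, abs_le]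
    rw [abs_le] at h1 h2
    constructor <;> linarith
  have hP : ∏ p ∈ N.primesLE, (1 - 1 / (p : ℝ))⁻¹ =
      exp eulerMascheroniConstant * log N * exp δ := by
    rw [prod_primesLE_inv_eq_exp]
    conv_rhs => rw [(Real.exp_log hL).symm]
    rw [← Real.exp_add, ← Real.exp_add, hδ]
    ring_nf
  rw [hP, ← mul_sub_one, abs_mul, abs_of_pos (by positivity)]
  have h4 : |exp δ - 1| ≤ K' / log N * exp (K' / log 2) := by
    refine (abs_exp_sub_one_le_mul_exp_abs δ).trans ?_
    have : K' / log N ≤ K' / log 2 := by gcongr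
    gcongr
    exact hδb.trans this
  calc exp eulerMascheroniConstant * log N * |exp δ - 1|
      ≤ exp eulerMascheroniConstant * log N * (K' / log N * exp (K' / log 2)) := by gcongr
    _ = exp eulerMascheroniConstant * (K' * exp (K' / log 2)) := by field_simp
    _ ≤ _ := by linarith

theorem exists_abs_prod_primesLE_floor_inv_sub_le :
    ∃ C, 0 < C ∧ ∀ y : ℝ, 1 ≤ y →
      |∏ p ∈ Nat.primesLE ⌊y⌋₊, (1 - 1 / (p : ℝ))⁻¹ - exp eulerMascheroniConstant * log y| ≤
        C := by
  obtain ⟨C, hC, h⟩ := exists_abs_prod_primesLE_inv_sub_le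
  refine ⟨C + exp eulerMascheroniConstant, by positivity, fun y hy => ?_⟩
  have hN : 1 ≤ ⌊y⌋₊ := (Nat.one_le_floor_iff y).2 hy
  have hN' : (1 : ℝ) ≤ ⌊y⌋₊ := by exact_mod_cast hN
  have h1 := h _ hN
  have h2 : log ⌊y⌋₊ ≤ log y := Real.log_le_log (by linarith) (Nat.floor_le (by linarith))
  have h3 : log y ≤ log ⌊y⌋₊ + 1 := by
    have h4 : y ≤ 2 * ⌊y⌋₊ := by linarith [Nat.lt_floor_add_one y]
    have h5 := Real.log_le_log (by linarith) h4
    rw [Real.log_mul (by norm_num) (by linarith)] at h5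
    linarith [Real.log_two_lt_d9]
  have he := Real.exp_pos eulerMascheroniConstant
  rw [abs_le] at h1 ⊢
  constructor <;> nlinarith

theorem exists_sum_primesLE_inv_sub_one_le :
    ∃ C, 0 < C ∧ ∀ x : ℝ, 3 ≤ x →
      ∑ p ∈ Nat.primesLE ⌊x⌋₊, 1 / ((p : ℝ) - 1) ≤ C * log (log x) := by
  obtain ⟨K, M, hK, hM⟩ := exists_abs_sum_inv_primesLE_sub_log_log_sub_le
  have hlog3 : 1 < log 3 := by
    rw [Real.lt_log_iff_exp_lt (by norm_num)]
    exact Real.exp_one_lt_d9.trans (by norm_num)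
  have hL3 : 0 < log (log 3) := Real.log_pos hlog3
  refine ⟨2 * (1 + (|M| + K) / log (log 3)), by positivity, fun x hx => ?_⟩
  have hN : 3 ≤ ⌊x⌋₊ := Nat.le_floor (by exact_mod_cast hx)
  have hN' : (3 : ℝ) ≤ ⌊x⌋₊ := by exact_mod_cast hN
  have h1 := hM _ (by omega : 2 ≤ ⌊x⌋₊)
  have hl : 1 < log ⌊x⌋₊ := hlog3.trans_le (Real.log_le_log (by norm_num) hN')
  have h2 : log ⌊x⌋₊ ≤ log x := Real.log_le_log (by linarith) (Nat.floor_le (by linarith))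
  have h3 : log (log ⌊x⌋₊) ≤ log (log x) := Real.log_le_log (by linarith) h2
  have h4 : log (log 3) ≤ log (log x) :=
    Real.log_le_log (by linarith) (Real.log_le_log (by norm_num) hx)
  have h5 : K / log ⌊x⌋₊ ≤ K := div_le_self hK.le hl.le
  have h6 : ∑ p ∈ Nat.primesLE ⌊x⌋₊, 1 / ((p : ℝ) - 1) ≤
      2 * ∑ p ∈ Nat.primesLE ⌊x⌋₊, 1 / (p : ℝ) := by
    rw [Finset.mul_sum]
    refine Finset.sum_le_sum fun p hp => ?_
    have h2 : (2 : ℝ) ≤ p := by exact_mod_cast (Nat.prime_of_mem_primesLE hp).two_le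
    rw [mul_one_div, div_le_div_iff₀ (by linarith) (by linarith)]
    linarith
  have h7 : |M| + K ≤ (|M| + K) / log (log 3) * log (log x) := by
    rw [div_mul_eq_mul_div, le_div_iff₀ hL3]
    gcongr
  have h8 := (abs_le.1 h1).2
  have h9 := le_abs_self M
  nlinarith

theorem sq_one_sub_mul_sum_range_sub_mul_pow (r : ℝ) (n : ℕ) :
    (1 - r) ^ 2 * ∑ i ∈ Finset.range n, ((n : ℝ) - i) * r ^ i = n * (1 - r) - r + r ^ (n + 1) := by
  induction n with
  | zero => simp
  | succ n ih =>
    have h : ∑ i ∈ Finset.range (n + 1), (((n + 1 : ℕ) : ℝ) - i) * r ^ i =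
        r * ∑ i ∈ Finset.range n, ((n : ℝ) - i) * r ^ i + (n + 1) := by
      rw [Finset.sum_range_succ', Finset.mul_sum]
      congr 1
      · refine Finset.sum_congr rfl fun i _ => ?_
        push_cast
        ring
      · simp
    rw [h, mul_add, mul_left_comm, ih]
    push_cast
    ring

theorem one_sub_sum_le_prod_one_sub_of_mem_Icc {ι : Type*} (s : Finset ι) (u : ι → ℝ)
    (h0 : ∀ i ∈ s, 0 ≤ u i) (h1 : ∀ i ∈ s, u i ≤ 1) :
    1 - ∑ i ∈ s, u i ≤ ∏ i ∈ s, (1 - u i) := by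
  classical
  induction s using Finset.induction_on with
  | empty => simp
  | insert a s ha ih =>
    rw [Finset.sum_insert ha, Finset.prod_insert ha]
    have ih := ih (fun i hi => h0 i (Finset.mem_insert_of_mem hi))
      fun i hi => h1 i (Finset.mem_insert_of_mem hi)
    have ha0 := h0 a (Finset.mem_insert_self a s)
    have ha1 := h1 a (Finset.mem_insert_self a s)
    have hp : ∏ i ∈ s, (1 - u i) ≤ 1 :=
      Finset.prod_le_one (fun i hi => by linarith [h1 i (Finset.mem_insert_of_mem hi)])
        fun i hi => by linarith [h0 i (Finset.mem_insert_of_mem hi)]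
    nlinarith

open ArithmeticFunction in
theorem sum_divisors_one_div_mul_card_divisors_prod_prime_pow (T : Finset ℕ)
    (hT : ∀ p ∈ T, p.Prime) (e : ℕ) :
    ∑ k ∈ (∏ p ∈ T, p ^ e).divisors,
        (1 / (k : ℝ)) * (((∏ p ∈ T, p ^ e) / k).divisors.card : ℝ) =
      ∏ p ∈ T, ∑ i ∈ Finset.range (e + 1), (((e + 1 : ℕ) : ℝ) - i) * (1 / (p : ℝ)) ^ i := by
  let f : ArithmeticFunction ℝ := ⟨fun k => 1 / (k : ℝ), by simp⟩
  have hf : f.IsMultiplicative := ⟨by simp [f], fun {m n} _ => by simp [f, mul_comm]⟩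
  have hg : (sigma 0 : ArithmeticFunction ℝ).IsMultiplicative :=
    isMultiplicative_sigma.natCast
  have hfg : ∀ n : ℕ, (f * (sigma 0 : ArithmeticFunction ℝ)) n =
      ∑ k ∈ n.divisors, (1 / (k : ℝ)) * ((n / k).divisors.card : ℝ) := fun n => by
    rw [ArithmeticFunction.mul_apply,
      Nat.sum_divisorsAntidiagonal (fun a b => f a * (sigma 0 : ArithmeticFunction ℝ) b)]
    refine Finset.sum_congr rfl fun k _ => ?_
    simp [f, sigma_zero_apply]
  rw [← hfg, (hf.mul hg).map_prod (fun p => p ^ e) T fun p hp q hq hpq =>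
    Nat.coprime_pow_primes e e (hT p hp) (hT q hq) hpq]
  refine Finset.prod_congr rfl fun p hp => ?_
  rw [hfg, Nat.sum_divisors_prime_pow (hT p hp)]
  refine Finset.sum_congr rfl fun i hi => ?_
  have hi : i ≤ e := Nat.lt_succ_iff.1 (Finset.mem_range.1 hi)
  rw [Nat.pow_div hi (hT p hp).pos, ← sigma_zero_apply, sigma_zero_apply_prime_pow (hT p hp)]
  push_cast [Nat.cast_sub hi]
  rw [one_div_pow]
  ring

theorem card_filter_dvd_divisors {k n : ℕ} (hn : n ≠ 0) (h : k ∣ n) :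
    (n.divisors.filter (fun m => k ∣ m)).card = (n / k).divisors.card := by
  obtain ⟨l, rfl⟩ := h
  have hk : 0 < k := Nat.pos_of_ne_zero (left_ne_zero_of_mul hn)
  rw [Nat.mul_div_cancel_left l hk]
  symm
  refine Finset.card_bij (fun a _ => k * a) (fun a ha => ?_) (fun a _ b _ hab => ?_) fun m hm => ?_
  · rw [Finset.mem_filter, Nat.mem_divisors]
    exact ⟨⟨mul_dvd_mul_left k (Nat.dvd_of_mem_divisors ha), hn⟩, dvd_mul_right k a⟩
  · exact Nat.eq_of_mul_eq_mul_left hk hab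
  · rw [Finset.mem_filter, Nat.mem_divisors] at hm
    obtain ⟨⟨h1, -⟩, a, rfl⟩ := hm
    exact ⟨a, Nat.mem_divisors.2 ⟨Nat.dvd_of_mul_dvd_mul_left hk h1, right_ne_zero_of_mul hn⟩, rfl⟩

theorem card_divisors_prod_prime_pow (T : Finset ℕ) (hT : ∀ p ∈ T, p.Prime) (e : ℕ) :
    (∏ p ∈ T, p ^ e).divisors.card = (e + 1) ^ T.card := by
  rw [← ArithmeticFunction.sigma_zero_apply,
    ArithmeticFunction.isMultiplicative_sigma.map_prod (fun p => p ^ e) T fun p hp q hq hpq =>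
      Nat.coprime_pow_primes e e (hT p hp) (hT q hq) hpq,
    Finset.prod_congr rfl fun p hp => ArithmeticFunction.sigma_zero_apply_prime_pow (hT p hp),
    Finset.prod_const]

theorem sum_divisors_one_div_mul_card_filter_dvd {T S : Finset ℕ} (hTS : T ⊆ S)
    (hS : ∀ p ∈ S, p.Prime) {b : ℕ} (hb : 1 ≤ b) :
    ∑ k ∈ (∏ p ∈ T, p ^ (b - 1)).divisors, (1 / (k : ℝ)) *
        (((∏ p ∈ S, p ^ (b - 1)).divisors.filter (fun m => k ∣ m)).card : ℝ) =
      ((∏ p ∈ S, p ^ (b - 1)).divisors.card : ℝ) *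
        ∏ p ∈ T, ((∑ i ∈ Finset.range b, ((b : ℝ) - i) * (1 / (p : ℝ)) ^ i) / b) := by
  obtain ⟨e, rfl⟩ := Nat.exists_eq_add_of_le' hb
  rw [Nat.add_sub_cancel]
  have hT : ∀ p ∈ T, p.Prime := fun p hp => hS p (hTS hp)
  have hU : ∀ p ∈ S \ T, p.Prime := fun p hp => hS p (Finset.sdiff_subset hp)
  have hne : ∀ V : Finset ℕ, (∀ p ∈ V, p.Prime) → ∏ p ∈ V, p ^ e ≠ 0 := fun V hV =>
    Finset.prod_ne_zero_iff.2 fun p hp => pow_ne_zero _ (hV p hp).ne_zero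
  have hmul : (∏ p ∈ S \ T, p ^ e) * ∏ p ∈ T, p ^ e = ∏ p ∈ S, p ^ e :=
    Finset.prod_sdiff hTS
  have hcop : Nat.Coprime (∏ p ∈ S \ T, p ^ e) (∏ p ∈ T, p ^ e) :=
    Nat.Coprime.prod_left fun p hp => Nat.Coprime.prod_right fun q hq =>
      Nat.coprime_pow_primes e e (hU p hp) (hT q hq) fun h =>
        (Finset.mem_sdiff.1 hp).2 (h ▸ hq)
  have hterm : ∀ k ∈ (∏ p ∈ T, p ^ e).divisors, (1 / (k : ℝ)) *
      (((∏ p ∈ S, p ^ e).divisors.filter (fun m => k ∣ m)).card : ℝ) =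
      ((e + 1 : ℕ) : ℝ) ^ (S \ T).card *
        ((1 / (k : ℝ)) * (((∏ p ∈ T, p ^ e) / k).divisors.card : ℝ)) := fun k hk => by
    have hk := Nat.dvd_of_mem_divisors hk
    rw [card_filter_dvd_divisors (hne S hS) (hk.trans (hmul ▸ dvd_mul_left _ _)), ← hmul,
      Nat.mul_div_assoc _ hk,
      (hcop.coprime_dvd_right (Nat.div_dvd_of_dvd hk)).card_divisors_mul,
      card_divisors_prod_prime_pow _ hU]
    push_cast
    ring
  rw [Finset.sum_congr rfl hterm, ← Finset.mul_sum,
    sum_divisors_one_div_mul_card_divisors_prod_prime_pow T hT, Finset.prod_div_distrib,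
    Finset.prod_const, card_divisors_prod_prime_pow S hS, ← Finset.card_sdiff_add_card_eq_card hTS,
    pow_add]
  push_cast
  field_simp

theorem weighted_geom_sum_bounds {r : ℝ} (h0 : 0 ≤ r) (h1 : r < 1) {b : ℕ} (hb : 1 ≤ b) :
    1 - r / (b * (1 - r)) ≤ (∑ i ∈ Finset.range b, ((b : ℝ) - i) * r ^ i) / b * (1 - r) ∧
      (∑ i ∈ Finset.range b, ((b : ℝ) - i) * r ^ i) / b * (1 - r) ≤ 1 := by
  have hb' : (0 : ℝ) < b := by exact_mod_cast hb
  have hr : 0 < 1 - r := by linarith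
  have h := sq_one_sub_mul_sum_range_sub_mul_pow r b
  have hE : (∑ i ∈ Finset.range b, ((b : ℝ) - i) * r ^ i) / b * (1 - r) =
      (b * (1 - r) - r + r ^ (b + 1)) / (b * (1 - r)) := by
    rw [← h]
    field_simp
  have hp : r ^ (b + 1) ≤ r := by
    simpa using pow_le_pow_of_le_one h0 h1.le (Nat.le_add_left 1 b)
  have hp0 : 0 ≤ r ^ (b + 1) := pow_nonneg h0 _
  rw [hE]
  constructor
  · rw [one_sub_div (by positivity)]
    gcongr
    linarith
  · rw [div_le_one (by positivity)]
    linarith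

theorem abs_prod_weighted_geom_sum_sub_prod_inv_le (T : Finset ℕ) (hT : ∀ p ∈ T, p.Prime) {b : ℕ}
    (hb : 1 ≤ b) :
    |∏ p ∈ T, ((∑ i ∈ Finset.range b, ((b : ℝ) - i) * (1 / (p : ℝ)) ^ i) / b) -
        ∏ p ∈ T, (1 - 1 / (p : ℝ))⁻¹| ≤
      (∏ p ∈ T, (1 - 1 / (p : ℝ))⁻¹) * ((∑ p ∈ T, 1 / ((p : ℝ) - 1)) / b) := by
  have hb' : (1 : ℝ) ≤ b := by exact_mod_cast hb
  set a : ℕ → ℝ := fun p =>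
    (∑ i ∈ Finset.range b, ((b : ℝ) - i) * (1 / (p : ℝ)) ^ i) / b * (1 - 1 / (p : ℝ)) with ha
  set u : ℕ → ℝ := fun p => 1 / ((p : ℝ) - 1) / b with hu
  have h2 : ∀ p ∈ T, (2 : ℝ) ≤ p := fun p hp => by exact_mod_cast (hT p hp).two_le
  have hr : ∀ p ∈ T, 0 < 1 - 1 / (p : ℝ) := fun p hp => by
    linarith [one_div_natPrimes_le ⟨p, hT p hp⟩]
  have hab : ∀ p ∈ T, 1 - u p ≤ a p ∧ a p ≤ 1 := fun p hp => by
    have h := weighted_geom_sum_bounds (r := 1 / (p : ℝ)) (by positivity)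
      (by linarith [hr p hp]) hb
    refine ⟨le_of_eq_of_le ?_ h.1, h.2⟩
    have h3 := h2 p hp
    have h4 : (p : ℝ) - 1 ≠ 0 := by linarith
    have h5 : (p : ℝ) ≠ 0 := by linarith
    simp only [hu]
    rw [one_sub_div h5]
    field_simp
  have hu0 : ∀ p ∈ T, 0 ≤ u p := fun p hp => by
    have : (0 : ℝ) ≤ (p : ℝ) - 1 := by linarith [h2 p hp]
    positivity
  have hu1 : ∀ p ∈ T, u p ≤ 1 := fun p hp => by
    have h3 : (1 : ℝ) ≤ (p : ℝ) - 1 := by linarith [h2 p hp]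
    exact div_le_one_of_le₀ (((div_le_one (by linarith)).2 h3).trans hb') (by linarith)
  have hE : 0 ≤ ∏ p ∈ T, (1 - 1 / (p : ℝ))⁻¹ :=
    Finset.prod_nonneg fun p hp => (inv_pos.2 (hr p hp)).le
  have hS : ∏ p ∈ T, ((∑ i ∈ Finset.range b, ((b : ℝ) - i) * (1 / (p : ℝ)) ^ i) / b) =
      (∏ p ∈ T, (1 - 1 / (p : ℝ))⁻¹) * ∏ p ∈ T, a p := by
    rw [← Finset.prod_mul_distrib]
    refine Finset.prod_congr rfl fun p hp => ?_
    simp only [ha]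
    rw [mul_comm, mul_assoc, mul_inv_cancel₀ (hr p hp).ne', mul_one]
  have hlow : 1 - (∑ p ∈ T, 1 / ((p : ℝ) - 1)) / b ≤ ∏ p ∈ T, a p := by
    rw [Finset.sum_div]
    exact (one_sub_sum_le_prod_one_sub_of_mem_Icc T u hu0 hu1).trans
      (Finset.prod_le_prod (fun p hp => by linarith [hu1 p hp]) fun p hp => (hab p hp).1)
  have hup : ∏ p ∈ T, a p ≤ 1 :=
    Finset.prod_le_one (fun p hp => by linarith [hu1 p hp, (hab p hp).1]) fun p hp => (hab p hp).2
  rw [hS, ← mul_sub_one, abs_mul, abs_of_nonneg hE]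
  refine mul_le_mul_of_nonneg_left ?_ hE
  rw [abs_of_nonpos (by linarith)]
  linarith

theorem exists_abs_prod_weighted_geom_sum_sub_le :
    ∃ C : ℝ, 0 < C ∧ ∀ x y : ℝ, 3 ≤ x → 1 ≤ y → y ≤ x → ∀ b : ℕ, 1 ≤ b →
      |∏ p ∈ Nat.primesLE ⌊y⌋₊, ((∑ i ∈ Finset.range b, ((b : ℝ) - i) * (1 / (p : ℝ)) ^ i) / b) -
          exp eulerMascheroniConstant * log y| ≤ C * (1 + log x * log (log x) / b) := by
  obtain ⟨C₁, hC₁, h₁⟩ := exists_abs_prod_primesLE_floor_inv_sub_le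
  obtain ⟨C₂, hC₂, h₂⟩ := exists_sum_primesLE_inv_sub_one_le
  have he := Real.exp_pos eulerMascheroniConstant
  refine ⟨C₁ + (exp eulerMascheroniConstant + C₁) * C₂, by positivity,
    fun x y hx hy hyx b hb => ?_⟩
  have hb' : (0 : ℝ) < b := by exact_mod_cast hb
  have hL : 1 ≤ log x := by
    rw [Real.le_log_iff_exp_le (by linarith)]
    linarith [Real.exp_one_lt_d9]
  have hLL : 0 ≤ log (log x) := Real.log_nonneg hL
  have hE := h₁ y hy
  have hS := abs_prod_weighted_geom_sum_sub_prod_inv_le (Nat.primesLE ⌊y⌋₊)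
    (fun p hp => Nat.prime_of_mem_primesLE hp) hb
  set E := ∏ p ∈ Nat.primesLE ⌊y⌋₊, (1 - 1 / (p : ℝ))⁻¹
  set S := ∏ p ∈ Nat.primesLE ⌊y⌋₊,
    ((∑ i ∈ Finset.range b, ((b : ℝ) - i) * (1 / (p : ℝ)) ^ i) / b)
  have hnonneg : ∀ p : ℕ, p.Prime → 0 ≤ 1 / ((p : ℝ) - 1) := fun p hp => by
    have : (1 : ℝ) ≤ p := by exact_mod_cast hp.one_le
    exact one_div_nonneg.2 (by linarith)
  have hsum : ∑ p ∈ Nat.primesLE ⌊y⌋₊, 1 / ((p : ℝ) - 1) ≤ C₂ * log (log x) := by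
    refine (Finset.sum_le_sum_of_subset_of_nonneg ?_ fun p hp _ => ?_).trans (h₂ x hx)
    · exact Nat.primesLE_mono (Nat.floor_le_floor hyx)
    · exact hnonneg p (Nat.prime_of_mem_primesLE hp)
  have hsum0 : 0 ≤ ∑ p ∈ Nat.primesLE ⌊y⌋₊, 1 / ((p : ℝ) - 1) :=
    Finset.sum_nonneg fun p hp => hnonneg p (Nat.prime_of_mem_primesLE hp)
  have hEL : E ≤ (exp eulerMascheroniConstant + C₁) * log x := by
    have h3 : log y ≤ log x := Real.log_le_log (by linarith) hyx
    have h4 := (abs_le.1 hE).2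
    nlinarith
  have hprod : E * ((∑ p ∈ Nat.primesLE ⌊y⌋₊, 1 / ((p : ℝ) - 1)) / b) ≤
      (exp eulerMascheroniConstant + C₁) * C₂ * (log x * log (log x) / b) := by
    calc E * ((∑ p ∈ Nat.primesLE ⌊y⌋₊, 1 / ((p : ℝ) - 1)) / b)
        ≤ (exp eulerMascheroniConstant + C₁) * log x * (C₂ * log (log x) / b) := by gcongr
      _ = _ := by ring
  have hq : 0 ≤ log x * log (log x) / b := by positivity
  calc |S - exp eulerMascheroniConstant * log y|
      ≤ |S - E| + |E - exp eulerMascheroniConstant * log y| := abs_sub_le _ _ _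
    _ ≤ (exp eulerMascheroniConstant + C₁) * C₂ * (log x * log (log x) / b) + C₁ :=
        add_le_add (hS.trans hprod) hE
    _ ≤ _ := by
        have := mul_nonneg hC₁.le hq
        have : 0 ≤ (exp eulerMascheroniConstant + C₁) * C₂ := by positivity
        linarith

theorem resonatorProd_ne_zero (x : ℝ) (b : ℕ) : resonatorProd x b ≠ 0 :=
  Finset.prod_ne_zero_iff.2 fun _ hp => pow_ne_zero _ (Nat.prime_of_mem_primesLE hp).ne_zero

theorem divisors_resonatorProd_subset {y z : ℝ} (h : y ≤ z) (b : ℕ) :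
    (resonatorProd y b).divisors ⊆ (resonatorProd z b).divisors :=
  Nat.divisors_subset_of_dvd (resonatorProd_ne_zero z b) <|
    Finset.prod_dvd_prod_of_subset _ _ _ (Nat.primesLE_mono (Nat.floor_le_floor h))

theorem sum_divisors_resonatorProd {x y : ℝ} (h : y ≤ x) {b : ℕ} (hb : 1 ≤ b) :
    ∑ k ∈ (resonatorProd y b).divisors, (1 / (k : ℝ)) *
        (((resonatorProd x b).divisors.filter (fun m => k ∣ m)).card : ℝ) =
      ((resonatorProd x b).divisors.card : ℝ) * ∏ p ∈ Nat.primesLE ⌊y⌋₊,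
        ((∑ i ∈ Finset.range b, ((b : ℝ) - i) * (1 / (p : ℝ)) ^ i) / b) :=
  sum_divisors_one_div_mul_card_filter_dvd (Nat.primesLE_mono (Nat.floor_le_floor h))
    (fun _ hp => Nat.prime_of_mem_primesLE hp) hb

/-- asymptotic evaluation of `Σ_{k ∈ M_j \ M_{j-1}} (1/k) · #{m ∈ M : k ∣ m}`. -/
theorem sum_over_Mj_diff_asymptotic :
    ∃ C : ℝ, 0 < C ∧ ∀ x : ℝ, 3 ≤ x → ∀ b J j : ℕ, 1 ≤ b → 1 ≤ J → 1 ≤ j → j ≤ J →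
      |(∑ k ∈ (resonatorProd (x ^ ((j : ℝ) / (J : ℝ))) b).divisors \
            (resonatorProd (x ^ (((j : ℝ) - 1) / (J : ℝ))) b).divisors,
            (1 / (k : ℝ)) *
              ((resonatorProd x b).divisors.filter (fun m => k ∣ m)).card)
          - (((resonatorProd x b).divisors.card : ℝ) / (J : ℝ)) *
              Real.exp Real.eulerMascheroniConstant * Real.log x|
        ≤ C * ((((resonatorProd x b).divisors.card : ℝ) / (J : ℝ)) *
              Real.exp Real.eulerMascheroniConstant * Real.log x) *
            ((J : ℝ) * Real.log (Real.log x) / (b : ℝ) + (J : ℝ) ^ 2 / Real.log x) := by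
  obtain ⟨C, hC, h⟩ := exists_abs_prod_weighted_geom_sum_sub_le
  have he := Real.exp_pos eulerMascheroniConstant
  refine ⟨2 * C / exp eulerMascheroniConstant, by positivity, fun x hx b J j hb hJ hj hjJ => ?_⟩
  have hb' : (0 : ℝ) < b := by exact_mod_cast hb
  have hJ' : (1 : ℝ) ≤ J := by exact_mod_cast hJ
  have hj' : (1 : ℝ) ≤ j := by exact_mod_cast hj
  have hjJ' : (j : ℝ) ≤ J := by exact_mod_cast hjJ
  have hx1 : 1 ≤ x := by linarith
  have hL : 0 < log x := Real.log_pos (by linarith)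
  have hpow : ∀ t : ℝ, 0 ≤ t → t ≤ 1 → 1 ≤ x ^ t ∧ x ^ t ≤ x := fun t h0 h1 =>
    ⟨Real.one_le_rpow hx1 h0, Real.rpow_le_self_of_one_le hx1 h1⟩
  obtain ⟨hy1, hyx⟩ := hpow (j / J) (by positivity) ((div_le_one (by linarith)).2 hjJ')
  obtain ⟨hz1, hzx⟩ := hpow ((j - 1) / J) (div_nonneg (by linarith) (by linarith))
    ((div_le_one (by linarith)).2 (by linarith))
  have hzy : x ^ (((j : ℝ) - 1) / J) ≤ x ^ ((j : ℝ) / J) :=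
    Real.rpow_le_rpow_of_exponent_le hx1 (by gcongr; linarith)
  have hy := h x _ hx hy1 hyx b hb
  have hz := h x _ hx hz1 hzx b hb
  rw [Real.log_rpow (by linarith)] at hy hz
  have hsum := Finset.sum_sdiff (f := fun k : ℕ => (1 / (k : ℝ)) *
    (((resonatorProd x b).divisors.filter (fun m => k ∣ m)).card : ℝ))
    (divisors_resonatorProd_subset hzy b)
  rw [sum_divisors_resonatorProd hyx hb, sum_divisors_resonatorProd hzx hb] at hsum
  rw [eq_sub_of_add_eq hsum]
  set S := ∏ p ∈ Nat.primesLE ⌊x ^ ((j : ℝ) / J)⌋₊,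
    ((∑ i ∈ Finset.range b, ((b : ℝ) - i) * (1 / (p : ℝ)) ^ i) / b)
  set S' := ∏ p ∈ Nat.primesLE ⌊x ^ (((j : ℝ) - 1) / J)⌋₊,
    ((∑ i ∈ Finset.range b, ((b : ℝ) - i) * (1 / (p : ℝ)) ^ i) / b)
  set M : ℝ := ((resonatorProd x b).divisors.card : ℝ)
  have hM : 0 ≤ M := Nat.cast_nonneg _
  have hmain : M * S - M * S' - M / J * exp eulerMascheroniConstant * log x =
      M * ((S - exp eulerMascheroniConstant * (j / J * log x)) -
        (S' - exp eulerMascheroniConstant * ((j - 1) / J * log x))) := by ring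
  have hR : 2 * C / exp eulerMascheroniConstant *
      (M / J * exp eulerMascheroniConstant * log x) *
        (J * log (log x) / b + J ^ 2 / log x) =
      M * (2 * C * (J + log x * log (log x) / b)) := by
    field_simp
    ring
  rw [hmain, hR, abs_mul, abs_of_nonneg hM]
  refine mul_le_mul_of_nonneg_left ((abs_sub _ _).trans ?_) hM
  nlinarith
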